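/- A topological space X is H(i) (every open cover has a finite subfamily with dense union) if and only if every open filter base on X has nonempty adherence. -/

import Mathlib

open Cardinal Set

universe u v

/-- `x` is a `D`-limit point of the family of sets `O`. -/
def DLimitSets {X : Type u} {I : Type v} [TopologicalSpace X]
    (D : Ultrafilter I) (O : I → Set X) (x : X) : Prop :=
  ∀ U ∈ nhds x, {i | (U ∩ O i).Nonempty} ∈ D

/-- `X` is `D`-pseudocompact. -/
def DPseudocompact (X : Type u) {I : Type v} [TopologicalSpace X]
    (D : Ultrafilter I) : Prop :=
  ∀ O : I → Set X, (∀ i, IsOpen (O i)) → (∀ i, (O i).Nonempty) →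
    ∃ x : X, DLimitSets D O x

/-- Every open cover of cardinality at most `lam` has a finite subfamily with dense union. -/
def WeaklyInitiallyCompact (X : Type u) [TopologicalSpace X] (lam : Cardinal.{u}) : Prop :=
  ∀ 𝒰 : Set (Set X), (∀ U ∈ 𝒰, IsOpen U) → ⋃₀ 𝒰 = Set.univ →
    Cardinal.mk 𝒰 ≤ lam →
    ∃ t : Finset (Set X), ↑t ⊆ 𝒰 ∧ Dense (⋃₀ (t : Set (Set X)))

/-- A regular ultrafilter over `I` (regular of degree `|I|`): there is an `I`-indexed
family of members of `D` every infinite subfamily of which has empty intersection. -/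
def RegularUltrafilter {I : Type v} (D : Ultrafilter I) : Prop :=
  ∃ Z : I → Set I, (∀ i, Z i ∈ D) ∧
    ∀ S : Set I, S.Infinite → ⋂ i ∈ S, Z i = ∅

/-- If each of finitely many sets is disjoint from some member of a filter base, then a single
member of the base is disjoint from their union. -/
theorem exists_mem_disjoint_sUnion_of_finite {X : Type u} {B : Set (Set X)} (hne : B.Nonempty)
    (hdir : ∀ U ∈ B, ∀ V ∈ B, ∃ W ∈ B, W ⊆ U ∩ V) {t : Set (Set X)} (ht : t.Finite)
    (h : ∀ V ∈ t, ∃ U ∈ B, Disjoint U V) : ∃ W ∈ B, Disjoint W (⋃₀ t) := by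
  induction t, ht using Set.Finite.induction_on with
  | empty =>
    obtain ⟨W, hW⟩ := hne
    exact ⟨W, hW, by simp⟩
  | @insert a s _ _ ih =>
    obtain ⟨W, hW, hWs⟩ := ih fun V hV => h V (mem_insert_of_mem a hV)
    obtain ⟨U, hU, hUa⟩ := h a (mem_insert a s)
    obtain ⟨Z, hZ, hZUW⟩ := hdir U hU W hW
    refine ⟨Z, hZ, ?_⟩
    rw [sUnion_insert, disjoint_union_right]
    exact ⟨hUa.mono_left (hZUW.trans inter_subset_left),
      hWs.mono_left (hZUW.trans inter_subset_right)⟩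

theorem hi_iff_open_filter_base_adherence {X : Type u} [TopologicalSpace X] :
    (∀ 𝒰 : Set (Set X), (∀ U ∈ 𝒰, IsOpen U) → ⋃₀ 𝒰 = Set.univ →
        ∃ t : Finset (Set X), ↑t ⊆ 𝒰 ∧ Dense (⋃₀ (t : Set (Set X)))) ↔
      (∀ B : Set (Set X), B.Nonempty →
        (∀ U ∈ B, IsOpen U ∧ U.Nonempty) →
        (∀ U ∈ B, ∀ V ∈ B, ∃ W ∈ B, W ⊆ U ∩ V) →
        (⋂ U ∈ B, closure U).Nonempty) := by
  constructor
  · intro h B hne hB hdir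
    by_contra hempty
    rw [not_nonempty_iff_eq_empty] at hempty
    obtain ⟨t, ht, hdense⟩ := h ((fun U => (closure U)ᶜ) '' B)
      (by rintro _ ⟨U, -, rfl⟩; exact isClosed_closure.isOpen_compl)
      (by rw [sUnion_image, ← compl_iInter₂, hempty, compl_empty])
    obtain ⟨W, hW, hdisj⟩ := exists_mem_disjoint_sUnion_of_finite hne hdir t.finite_toSet
      fun V hV => by
        obtain ⟨U, hU, rfl⟩ := ht hV
        exact ⟨U, hU, disjoint_compl_right.mono_left subset_closure⟩
    obtain ⟨x, hxW, hxt⟩ := hdense.inter_open_nonempty W (hB W hW).1 (hB W hW).2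
    exact disjoint_left.1 hdisj hxW hxt
  · classical
    intro h 𝒰 hopen hcover
    by_contra! hnd
    obtain ⟨x, hx⟩ := h
      ((fun t : Finset (Set X) => (closure (⋃₀ (t : Set (Set X))))ᶜ) '' {t | ↑t ⊆ 𝒰})
      ⟨_, ∅, by simp, rfl⟩
      (by
        rintro _ ⟨t, ht, rfl⟩
        refine ⟨isClosed_closure.isOpen_compl, ?_⟩
        rw [nonempty_compl, Ne, ← dense_iff_closure_eq]
        exact hnd t ht)
      (by
        rintro _ ⟨s, hs, rfl⟩ _ ⟨t, ht, rfl⟩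
        refine ⟨_, ⟨s ∪ t, by simpa using ⟨hs, ht⟩, rfl⟩, ?_⟩
        simp [sUnion_union, closure_union, compl_union])
    obtain ⟨U, hU, hxU⟩ : x ∈ ⋃₀ 𝒰 := hcover ▸ mem_univ x
    have hxc : x ∈ closure (closure U)ᶜ :=
      mem_iInter₂.1 hx _ ⟨{U}, by simpa using hU, by simp⟩
    obtain ⟨y, hyU, hyc⟩ := mem_closure_iff.1 hxc U (hopen U hU) hxU
    exact hyc (subset_closure hyU)
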